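/- (Lemma 4.1: differential relations.) For every integer n ≥ 0, every index 1 ≤ j ≤ N and every t ∈ U: the partial derivative ∂_j h_n(t) exists and equals −h_n(t)·R_{n,j}(t); the partial derivative ∂_j p(n,t) exists and equals r_{n,j}(t); consequently, for n ≥ 1, ∂_j ln β_n(t) = R_{n−1,j}(t) − R_{n,j}(t), and for n ≥ 0, ∂_j α_n(t) = r_{n,j}(t) − r_{n+1,j}(t). -/

import Mathlib

open MeasureTheory Polynomial

noncomputable def pd {N : ℕ} (j : Fin N) (f : (Fin N → ℝ) → ℝ) (x : Fin N → ℝ) : ℝ :=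
  deriv (fun s => f (Function.update x j s)) (x j)

open Set

theorem integrable_comp_abs_of_integrableOn_Ioi {f : ℝ → ℝ} (hf : IntegrableOn f (Ioi 0)) :
    Integrable fun x => f |x| := by
  have hpos : IntegrableOn (fun x => f |x|) (Ioi 0) :=
    hf.congr_fun (fun x hx => by rw [abs_of_pos (mem_Ioi.1 hx)]) measurableSet_Ioi
  have hneg : IntegrableOn (fun x => f |x|) (Iic 0) := by
    rw [← Measure.map_neg_eq_self (volume : Measure ℝ)]
    have m : MeasurableEmbedding fun x : ℝ => -x := (Homeomorph.neg ℝ).measurableEmbedding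
    rw [m.integrableOn_map_iff]
    simp_rw [Function.comp_def, abs_neg, neg_preimage, neg_Iic, neg_zero]
    exact Iff.mpr integrableOn_Ici_iff_integrableOn_Ioi hpos
  rw [← integrableOn_univ, ← Iic_union_Ioi (a := (0 : ℝ))]
  exact hneg.union hpos

theorem integrable_exp_neg_abs_mul_abs_rpow_sub_one {c : ℝ} (hc : 0 < c) :
    Integrable (fun u : ℝ => Real.exp (-|u|) * |u| ^ (c - 1)) :=
  integrable_comp_abs_of_integrableOn_Ioi (Real.GammaIntegral_convergent hc)

theorem integrable_exp_neg_abs_mul_abs_rpow {c : ℝ} (hc : 0 < c) :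
    Integrable (fun u : ℝ => Real.exp (-|u|) * |u| ^ c) := by
  simpa using integrable_exp_neg_abs_mul_abs_rpow_sub_one (c := c + 1) (by linarith)

/-- The kernel `|u| ^ c / u` is integrable against `exp (-|u|)`. -/
theorem integrable_exp_neg_abs_mul_abs_rpow_div {c : ℝ} (hc : 0 < c) :
    Integrable (fun u : ℝ => Real.exp (-|u|) * (|u| ^ c / u)) := by
  refine (integrable_exp_neg_abs_mul_abs_rpow_sub_one hc).mono'
    (Measurable.aestronglyMeasurable (by fun_prop)) (.of_forall fun u => ?_)
  rw [norm_mul, Real.norm_of_nonneg (Real.exp_pos _).le, norm_div, Real.norm_eq_abs,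
    Real.norm_eq_abs, abs_of_nonneg (by positivity : 0 ≤ |u| ^ c)]
  rcases eq_or_ne u 0 with rfl | hu
  · simp only [abs_zero, div_zero, mul_zero]
    positivity
  · rw [Real.rpow_sub_one (abs_ne_zero.2 hu)]

section Convolution

variable {g K : ℝ → ℝ} {C : ℝ}

theorem abs_translate_mul_le (hgC : ∀ y, |g y| ≤ C * Real.exp (-|y|)) (s u : ℝ) :
    ‖g (u + s) * K u‖ ≤ C * Real.exp |s| * ‖Real.exp (-|u|) * K u‖ := by
  have hC : 0 ≤ C := by
    have := (abs_nonneg _).trans (hgC 0)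
    simpa using this
  rw [norm_mul, norm_mul, Real.norm_of_nonneg (Real.exp_pos _).le, ← mul_assoc]
  gcongr
  refine (hgC _).trans ?_
  rw [mul_assoc, ← Real.exp_add]
  gcongr
  have := abs_sub_abs_le_abs_sub u (-s)
  rw [abs_neg, sub_neg_eq_add] at this
  linarith

theorem integrable_translate_mul (hg : Continuous g) (hgC : ∀ y, |g y| ≤ C * Real.exp (-|y|))
    (hK : Measurable K) (hKi : Integrable fun u => Real.exp (-|u|) * K u) (s : ℝ) :
    Integrable fun u => g (u + s) * K u :=
  (hKi.norm.const_mul (C * Real.exp |s|)).mono' (by fun_prop)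
    (.of_forall fun u => abs_translate_mul_le hgC s u)

theorem integrable_mul_translate (hg : Continuous g) (hgC : ∀ y, |g y| ≤ C * Real.exp (-|y|))
    (hK : Measurable K) (hKi : Integrable fun u => Real.exp (-|u|) * K u) (s : ℝ) :
    Integrable fun y => g y * K (y - s) := by
  simpa using (integrable_translate_mul hg hgC hK hKi s).comp_sub_right s

theorem continuous_integral_mul_translate (hg : Continuous g)
    (hgC : ∀ y, |g y| ≤ C * Real.exp (-|y|))
    (hK : Measurable K) (hKi : Integrable fun u => Real.exp (-|u|) * K u) :
    Continuous fun s => ∫ y, g y * K (y - s) := by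
  have htr : (fun s => ∫ y, g y * K (y - s)) = fun s => ∫ u, g (u + s) * K u := by
    ext s
    simpa using (integral_sub_right_eq_self (fun u => g (u + s) * K u) s)
  rw [htr, continuous_iff_continuousAt]
  intro s₀
  refine continuousAt_of_dominated (bound := fun u => C * Real.exp (|s₀| + 1) *
    ‖Real.exp (-|u|) * K u‖) (.of_forall fun s => by fun_prop) ?_ (hKi.norm.const_mul _)
    (.of_forall fun u => by fun_prop)
  filter_upwards [Metric.ball_mem_nhds s₀ one_pos] with s hs
  refine .of_forall fun u => (abs_translate_mul_le hgC s u).trans ?_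
  have hC : 0 ≤ C := by
    have := (abs_nonneg _).trans (hgC 0)
    simpa using this
  gcongr
  have := abs_sub_abs_le_abs_sub s s₀
  rw [Metric.mem_ball, Real.dist_eq] at hs
  linarith

end Convolution

theorem hasDerivAt_abs_sub_rpow (c : ℝ) {y s : ℝ} (h : s ≠ y) :
    HasDerivAt (fun s => |y - s| ^ c) (-c * (|y - s| ^ c / (y - s))) s := by
  have hne : y - s ≠ 0 := sub_ne_zero.2 h.symm
  have h1 : HasDerivAt (fun s => y - s) (-1) s := by simpa using (hasDerivAt_id s).const_sub y
  have h2 := ((hasDerivAt_abs hne).comp s h1).rpow_const (p := c) (Or.inl (abs_ne_zero.2 hne))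
  refine h2.congr_deriv ?_
  simp only [Function.comp]
  rw [Real.rpow_sub_one (abs_ne_zero.2 hne)]
  rcases lt_or_gt_of_ne hne with h0 | h0
  · rw [abs_of_neg h0, sign_neg h0, SignType.coe_neg_one, div_neg]
    ring
  · rw [abs_of_pos h0, sign_pos h0, SignType.coe_one]
    ring

theorem integral_abs_sub_rpow_div {c : ℝ} (hc : 0 < c) (y a b : ℝ) :
    ∫ s in a..b, -c * (|y - s| ^ c / (y - s)) = |y - b| ^ c - |y - a| ^ c := by
  refine integral_eq_of_hasDerivAt_off_countable (fun s => |y - s| ^ c) _ (countable_singleton y)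
    ?_ (fun s hs => hasDerivAt_abs_sub_rpow c hs.2) ?_
  · exact Continuous.continuousOn (by fun_prop (disch := positivity))
  · have h1 : IntervalIntegrable (fun u : ℝ => |u| ^ c / u) volume (y - a) (y - b) := by
      have := (integrable_exp_neg_abs_mul_abs_rpow_div hc).intervalIntegrable
        (a := y - a) (b := y - b) |>.continuousOn_mul (f := _) (g := fun u => Real.exp |u|)
          (Continuous.continuousOn (by fun_prop))
      refine this.congr (fun u _ => ?_)
      simp only [← mul_assoc, ← Real.exp_add, add_neg_cancel, Real.exp_zero, one_mul]
    simpa using (h1.comp_sub_left y).const_mul (-c)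

/-- Differentiation under the integral sign for a weight with a moving power-type zero. -/
theorem hasDerivAt_integral_mul_abs_sub_rpow {g : ℝ → ℝ} {C c : ℝ} (hc : 0 < c)
    (hg : Continuous g) (hgC : ∀ y, |g y| ≤ C * Real.exp (-|y|)) (a : ℝ) :
    HasDerivAt (fun s => ∫ y, g y * |y - s| ^ c)
      (-c * ∫ y, g y * (|y - a| ^ c / (y - a))) a := by
  have hK : Measurable fun u : ℝ => |u| ^ c / u := by fun_prop
  have hKi := integrable_exp_neg_abs_mul_abs_rpow_div hc
  have hcont := continuous_integral_mul_translate hg hgC hK hKi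
  have key : ∀ b, ∫ y, g y * |y - b| ^ c = (∫ y, g y * |y - a| ^ c) +
      ∫ s in a..b, -c * ∫ y, g y * (|y - s| ^ c / (y - s)) := by
    intro b
    have hint : ∀ s, Integrable fun y => g y * |y - s| ^ c := fun s =>
      integrable_mul_translate hg hgC (K := fun u => |u| ^ c) (by fun_prop)
        (integrable_exp_neg_abs_mul_abs_rpow hc) s
    rw [← sub_eq_iff_eq_add', ← integral_sub (hint b) (hint a)]
    have hprod : Integrable (Function.uncurry fun s y => -c * (g y * (|y - s| ^ c / (y - s))))
        ((volume.restrict (Set.uIoc a b)).prod volume) := by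
      refine Integrable.const_mul ?_ (-c)
      rw [integrable_prod_iff (Measurable.aestronglyMeasurable (by fun_prop))]
      refine ⟨.of_forall fun s => integrable_mul_translate hg hgC hK hKi s, ?_⟩
      have hcn := continuous_integral_mul_translate (g := fun y => ‖g y‖)
        (K := fun u => ‖|u| ^ c / u‖) (C := C) hg.norm (by simpa using hgC) hK.norm
        (by simpa [norm_mul] using hKi.norm)
      simp only [norm_mul]
      exact (hcn.intervalIntegrable a b).def'
    simp_rw [← integral_const_mul]
    rw [intervalIntegral_integral_swap hprod]
    refine integral_congr_ae (.of_forall fun y => ?_)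
    simp only
    rw [← mul_sub, ← integral_abs_sub_rpow_div hc, ← intervalIntegral.integral_const_mul]
    simp only [mul_left_comm]
  rw [funext key]
  exact ((hcont.const_mul (-c)).integral_hasStrictDerivAt a a).hasDerivAt.const_add _

/-- `f` grows at most exponentially. -/
def ExpGrowth (f : ℝ → ℝ) : Prop :=
  ∃ C a : ℝ, ∀ y, |f y| ≤ C * Real.exp (a * |y|)

namespace ExpGrowth

theorem mul {f g : ℝ → ℝ} (hf : ExpGrowth f) (hg : ExpGrowth g) :
    ExpGrowth fun y => f y * g y := by
  obtain ⟨C, a, hf⟩ := hf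
  obtain ⟨D, b, hg⟩ := hg
  refine ⟨C * D, a + b, fun y => ?_⟩
  rw [abs_mul, add_mul, Real.exp_add, mul_mul_mul_comm]
  exact mul_le_mul (hf y) (hg y) (abs_nonneg _) ((abs_nonneg _).trans (hf y))

theorem const (c : ℝ) : ExpGrowth fun _ => c := ⟨|c|, 0, fun y => by simp⟩

theorem add {f g : ℝ → ℝ} (hf : ExpGrowth f) (hg : ExpGrowth g) :
    ExpGrowth fun y => f y + g y := by
  obtain ⟨C, a, hf⟩ := hf
  obtain ⟨D, b, hg⟩ := hg
  have hC : 0 ≤ C := (abs_nonneg _).trans (by simpa using hf 0)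
  have hD : 0 ≤ D := (abs_nonneg _).trans (by simpa using hg 0)
  refine ⟨C + D, max a b, fun y => (abs_add_le _ _).trans ?_⟩
  rw [add_mul]
  refine add_le_add ((hf y).trans ?_) ((hg y).trans ?_)
  · gcongr
    exact le_max_left a b
  · gcongr
    exact le_max_right a b

theorem prod {ι : Type*} (s : Finset ι) {f : ι → ℝ → ℝ} (hf : ∀ i ∈ s, ExpGrowth (f i)) :
    ExpGrowth fun y => ∏ i ∈ s, f i y := by
  classical
  induction s using Finset.induction_on with
  | empty => simpa using const 1
  | insert i s hi ih =>
    simp only [Finset.prod_insert hi]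
    exact (hf i (by simp)).mul (ih fun k hk => hf k (by simp [hk]))

theorem abs_sub_rpow (x : ℝ) {c : ℝ} (hc : 0 ≤ c) : ExpGrowth fun y => |y - x| ^ c := by
  refine ⟨Real.exp (c * |x|), c, fun y => ?_⟩
  rw [abs_of_nonneg (by positivity), ← Real.exp_add, ← mul_add]
  calc |y - x| ^ c ≤ Real.exp (|x| + |y|) ^ c := by
        gcongr
        have := Real.add_one_le_exp (|x| + |y|)
        have := abs_sub y x
        linarith
    _ = Real.exp (c * (|x| + |y|)) := by rw [← Real.exp_mul, mul_comm]

theorem id : ExpGrowth fun y => y :=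
  ⟨1, 1, fun y => by simpa using (lt_add_one |y|).le.trans (Real.add_one_le_exp |y|)⟩

theorem polynomial (q : ℝ[X]) : ExpGrowth fun y => q.eval y := by
  induction q using Polynomial.induction_on' with
  | add p q hp hq => simpa using hp.add hq
  | monomial k a =>
    have := (const a).mul (prod (Finset.range k) fun _ _ => id)
    simpa using this

theorem exists_mul_gaussian_le {f : ℝ → ℝ} (hf : ExpGrowth f) :
    ∃ C, ∀ y, |f y * Real.exp (-y ^ 2)| ≤ C * Real.exp (-|y|) := by
  obtain ⟨C, a, hf⟩ := hf
  have hC : 0 ≤ C := (abs_nonneg _).trans (by simpa using hf 0)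
  refine ⟨C * Real.exp ((a + 1) ^ 2 / 4), fun y => ?_⟩
  rw [abs_mul, abs_of_pos (Real.exp_pos (-y ^ 2)), mul_assoc, ← Real.exp_add]
  calc |f y| * Real.exp (-y ^ 2) ≤ C * Real.exp (a * |y|) * Real.exp (-y ^ 2) := by
        gcongr
        exact hf y
    _ ≤ _ := by
        rw [mul_assoc, ← Real.exp_add]
        refine mul_le_mul_of_nonneg_left (Real.exp_le_exp.2 ?_) hC
        nlinarith [sq_nonneg (|y| - (a + 1) / 2), sq_abs y]

end ExpGrowth

section Weight

variable {N : ℕ}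

/-- The Gaussian weight with power-type zeros at the points `x k`. -/
noncomputable def zeroWeight (γ x : Fin N → ℝ) (y : ℝ) : ℝ :=
  Real.exp (-y ^ 2) * ∏ k, |y - x k| ^ γ k

/-- The factor of `q * zeroWeight γ x` that does not involve `x j`. -/
noncomputable def regularFactor (γ : Fin N → ℝ) (j : Fin N) (x : Fin N → ℝ) (q : ℝ[X]) (y : ℝ) :
    ℝ :=
  q.eval y * (∏ k ∈ Finset.univ.erase j, |y - x k| ^ γ k) * Real.exp (-y ^ 2)

variable {γ : Fin N → ℝ}

theorem eval_mul_zeroWeight (j : Fin N) (x : Fin N → ℝ) (q : ℝ[X]) (y : ℝ) :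
    q.eval y * zeroWeight γ x y = regularFactor γ j x q y * |y - x j| ^ γ j := by
  rw [zeroWeight, regularFactor, ← Finset.mul_prod_erase _ _ (Finset.mem_univ j)]
  ring

theorem regularFactor_update (j : Fin N) (x : Fin N → ℝ) (s : ℝ) (q : ℝ[X]) :
    regularFactor γ j (Function.update x j s) q = regularFactor γ j x q := by
  ext y
  simp only [regularFactor]
  congr 2
  refine Finset.prod_congr rfl fun k hk => ?_
  rw [Function.update_of_ne (Finset.ne_of_mem_erase hk)]

variable (hγ : ∀ j, 0 < γ j)
include hγ

theorem continuous_regularFactor (j : Fin N) (x : Fin N → ℝ) (q : ℝ[X]) :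
    Continuous (regularFactor γ j x q) := by
  unfold regularFactor
  have := fun k => (hγ k).le
  fun_prop (disch := exact this _)

theorem exists_abs_regularFactor_le (j : Fin N) (x : Fin N → ℝ) (q : ℝ[X]) :
    ∃ C, ∀ y, |regularFactor γ j x q y| ≤ C * Real.exp (-|y|) :=
  ((ExpGrowth.polynomial q).mul (ExpGrowth.prod _ fun k _ =>
    ExpGrowth.abs_sub_rpow (x k) (hγ k).le)).exists_mul_gaussian_le

theorem integrable_eval_mul_zeroWeight (j : Fin N) (x : Fin N → ℝ) (q : ℝ[X]) :
    Integrable fun y => q.eval y * zeroWeight γ x y := by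
  obtain ⟨C, hC⟩ := exists_abs_regularFactor_le hγ j x q
  simp only [eval_mul_zeroWeight j]
  exact integrable_mul_translate (continuous_regularFactor hγ j x q) hC
    (K := fun u => |u| ^ γ j) (by fun_prop) (integrable_exp_neg_abs_mul_abs_rpow (hγ j)) _

theorem hasDerivAt_integral_eval_mul_zeroWeight (j : Fin N) (x : Fin N → ℝ) (q : ℝ[X]) :
    HasDerivAt (fun s => ∫ y, q.eval y * zeroWeight γ (Function.update x j s) y)
      (-(γ j * ∫ y, q.eval y * zeroWeight γ x y / (y - x j))) (x j) := by
  obtain ⟨C, hC⟩ := exists_abs_regularFactor_le hγ j x q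
  simp only [eval_mul_zeroWeight j, regularFactor_update, Function.update_self, mul_div_assoc]
  rw [← neg_mul]
  exact hasDerivAt_integral_mul_abs_sub_rpow (hγ j) (continuous_regularFactor hγ j x q) hC (x j)

/-- Integration of polynomials against `zeroWeight γ x`. -/
noncomputable def weightFunctional (j : Fin N) (x : Fin N → ℝ) : ℝ[X] →ₗ[ℝ] ℝ where
  toFun q := ∫ y, q.eval y * zeroWeight γ x y
  map_add' p q := by
    simp only [eval_add, add_mul]
    exact integral_add (integrable_eval_mul_zeroWeight hγ j x p)
      (integrable_eval_mul_zeroWeight hγ j x q)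
  map_smul' c q := by
    simp only [eval_smul, smul_eq_mul, mul_assoc, integral_const_mul, RingHom.id_apply]

end Weight

section Algebra

/-- Coefficientwise differentiability of a curve of polynomials of locally bounded degree. -/
def HasPolyDerivAt (A : ℝ → ℝ[X]) (A' : ℝ[X]) (s₀ : ℝ) : Prop :=
  (∃ d, ∀ᶠ s in nhds s₀, (A s).natDegree ≤ d) ∧
    ∀ k, HasDerivAt (fun s => (A s).coeff k) (A'.coeff k) s₀

variable {A B : ℝ → ℝ[X]} {A' B' : ℝ[X]} {s₀ : ℝ}

theorem HasPolyDerivAt.mul (hA : HasPolyDerivAt A A' s₀) (hB : HasPolyDerivAt B B' s₀) :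
    HasPolyDerivAt (fun s => A s * B s) (A' * B s₀ + A s₀ * B') s₀ := by
  obtain ⟨⟨d, hd⟩, hA⟩ := hA
  obtain ⟨⟨e, he⟩, hB⟩ := hB
  refine ⟨⟨d + e, ?_⟩, fun k => ?_⟩
  · filter_upwards [hd, he] with s h1 h2
    exact natDegree_mul_le.trans (add_le_add h1 h2)
  · simp only [coeff_mul, coeff_add, ← Finset.sum_add_distrib]
    exact HasDerivAt.fun_sum fun i _ => (hA i.1).mul (hB i.2)

/-- Leibniz rule for a differentiable curve of functionals applied to one of polynomials. -/
theorem HasPolyDerivAt.hasDerivAt_apply (hA : HasPolyDerivAt A A' s₀) {L : ℝ → ℝ[X] →ₗ[ℝ] ℝ}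
    {D : ℝ[X] → ℝ} (hL : ∀ q, HasDerivAt (fun s => L s q) (D q) s₀) :
    HasDerivAt (fun s => L s (A s)) (L s₀ A' + D (A s₀)) s₀ := by
  obtain ⟨⟨d, hd⟩, hA⟩ := hA
  have hsum : ∀ (M : ℝ[X] →ₗ[ℝ] ℝ) (q : ℝ[X]), q.natDegree ≤ d →
      M q = ∑ k ∈ Finset.range (d + 1), q.coeff k * M (X ^ k) := by
    intro M q hq
    conv_lhs => rw [q.as_sum_range' (d + 1) (Nat.lt_succ_of_le hq)]
    rw [map_sum]
    refine Finset.sum_congr rfl fun k _ => ?_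
    rw [← smul_X_eq_monomial, map_smul, smul_eq_mul]
  have hA'd : A'.natDegree ≤ d := by
    rw [natDegree_le_iff_coeff_eq_zero]
    intro k hk
    refine (hA k).unique ((hasDerivAt_const s₀ (0 : ℝ)).congr_of_eventuallyEq ?_)
    filter_upwards [hd] with s hs
    exact coeff_eq_zero_of_natDegree_lt (hs.trans_lt hk)
  have hD : D (A s₀) = ∑ k ∈ Finset.range (d + 1), (A s₀).coeff k * D (X ^ k) := by
    refine (hL (A s₀)).unique ?_
    rw [funext fun s => hsum (L s) (A s₀) hd.self_of_nhds]
    exact HasDerivAt.fun_sum fun k _ => (hL _).const_mul _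
  rw [hsum _ _ hA'd, hD, ← Finset.sum_add_distrib]
  refine (HasDerivAt.fun_sum fun k _ => (hA k).mul (hL (X ^ k))).congr_of_eventuallyEq ?_
  filter_upwards [hd] with s hs
  exact hsum _ _ hs

theorem degree_sub_C_mul_lt {n : ℕ} {P q : ℝ[X]} (hP : P.Monic) (hPn : P.natDegree = n)
    (hq : q.degree < (n + 1 : ℕ)) : (q - C (q.coeff n) * P).degree < n := by
  rw [degree_lt_iff_coeff_zero] at hq ⊢
  intro m hm
  rw [coeff_sub, coeff_C_mul]
  rcases hm.eq_or_lt with rfl | hlt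
  · have : P.coeff n = 1 := by rw [← hPn]; exact hP
    rw [this, mul_one, sub_self]
  · rw [hq m hlt, coeff_eq_zero_of_natDegree_lt (hPn.trans_lt hlt), mul_zero, sub_zero]

variable {L : ℝ[X] →ₗ[ℝ] ℝ} {P : ℕ → ℝ[X]} (hP : ∀ n, (P n).Monic)
  (hPn : ∀ n, (P n).natDegree = n)
  (horth : ∀ m n, m ≠ n → L (P m * P n) = 0)
include hP hPn horth

theorem orthogonal_of_degree_lt {n : ℕ} {q : ℝ[X]} (hq : q.degree < n) : L (q * P n) = 0 := by
  have key : ∀ d ≤ n, ∀ q : ℝ[X], q.degree < d → L (q * P n) = 0 := by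
    intro d
    induction d with
    | zero =>
      intro _ q hq
      have : q = 0 := by simpa using hq
      rw [this, zero_mul, map_zero]
    | succ d ih =>
      intro hd q hq
      have h1 := ih (by omega) _ (degree_sub_C_mul_lt (hP d) (hPn d) hq)
      rw [sub_mul, map_sub, mul_assoc, ← smul_eq_C_mul, map_smul, horth d n (by omega), smul_zero,
        sub_zero] at h1
      exact h1
  exact key n le_rfl q hq

/-- Pairing with `P n` only sees the coefficient of degree `n`. -/
theorem apply_mul_of_degree_lt_succ {n : ℕ} {q : ℝ[X]} (hq : q.degree < (n + 1 : ℕ)) :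
    L (q * P n) = q.coeff n * L (P n * P n) := by
  have h1 := orthogonal_of_degree_lt hP hPn horth (degree_sub_C_mul_lt (hP n) (hPn n) hq)
  rwa [sub_mul, map_sub, mul_assoc, ← smul_eq_C_mul, map_smul, smul_eq_mul, sub_eq_zero] at h1

end Algebra

theorem hasPolyDerivAt_of_monic {A : ℝ → ℝ[X]} {s₀ : ℝ} {n : ℕ}
    (hA : ∀ᶠ s in nhds s₀, (A s).Monic ∧ (A s).natDegree = n)
    (hd : ∀ k, DifferentiableAt ℝ (fun s => (A s).coeff k) s₀) :
    ∃ A' : ℝ[X], A'.degree < n ∧ HasPolyDerivAt A A' s₀ := by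
  have hcoeff : ∀ k, (∑ i ∈ Finset.range n, monomial i (deriv (fun s => (A s).coeff i) s₀)).coeff k =
      if k < n then deriv (fun s => (A s).coeff k) s₀ else 0 := by
    intro k
    simp [coeff_monomial]
  refine ⟨∑ i ∈ Finset.range n, monomial i (deriv (fun s => (A s).coeff i) s₀), ?_, ⟨n, ?_⟩, ?_⟩
  · rw [degree_lt_iff_coeff_zero]
    intro k hk
    rw [hcoeff, if_neg hk.not_gt]
  · filter_upwards [hA] with s hs
    exact hs.2.le
  · intro k
    rw [hcoeff]
    split_ifs with hk
    · exact (hd k).hasDerivAt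
    · refine (hasDerivAt_const s₀ (if k = n then (1 : ℝ) else 0)).congr_of_eventuallyEq ?_
      filter_upwards [hA] with s ⟨h1, h2⟩
      split_ifs with hkn
      · rw [hkn, ← h2]
        exact h1
      · exact coeff_eq_zero_of_natDegree_lt (by omega)

theorem differential_relations
    (N : ℕ) (hN : 1 ≤ N) (γ : Fin N → ℝ) (hγ : ∀ j, 0 < γ j)
    (U : Set (Fin N → ℝ)) (hU : IsOpen U) (hUinj : ∀ x ∈ U, Function.Injective x)
    (w : (Fin N → ℝ) → ℝ → ℝ)
    (hw : ∀ x ∈ U, ∀ y : ℝ, w x y = Real.exp (-y ^ 2) * ∏ j, |y - x j| ^ γ j)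
    (P : ℕ → (Fin N → ℝ) → Polynomial ℝ)
    (hPmonic : ∀ n, ∀ x ∈ U, (P n x).Monic) (hPdeg : ∀ n, ∀ x ∈ U, (P n x).natDegree = n)
    (horth : ∀ m n, m ≠ n → ∀ x ∈ U, ∫ y : ℝ, (P m x).eval y * (P n x).eval y * w x y = 0)
    (h : ℕ → (Fin N → ℝ) → ℝ)
    (hh : ∀ n, ∀ x ∈ U, h n x = ∫ y : ℝ, ((P n x).eval y) ^ 2 * w x y)
    (hhpos : ∀ n, ∀ x ∈ U, 0 < h n x)
    (β : ℕ → (Fin N → ℝ) → ℝ) (hβ0 : ∀ x ∈ U, β 0 x = 0)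
    (hβ : ∀ n, ∀ x ∈ U, β (n + 1) x = h (n + 1) x / h n x)
    (α : ℕ → (Fin N → ℝ) → ℝ)
    (hα : ∀ n, ∀ x ∈ U, α n x = (∫ y : ℝ, y * ((P n x).eval y) ^ 2 * w x y) / h n x)
    (p : ℕ → (Fin N → ℝ) → ℝ) (hp0 : ∀ x ∈ U, p 0 x = 0)
    (hp : ∀ n, ∀ x ∈ U, p (n + 1) x = (P (n + 1) x).coeff n)
    (R : ℕ → Fin N → (Fin N → ℝ) → ℝ)
    (hR : ∀ n j, ∀ x ∈ U, R n j x = γ j / h n x * ∫ y : ℝ, ((P n x).eval y) ^ 2 * w x y / (y - x j))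
    (r : ℕ → Fin N → (Fin N → ℝ) → ℝ) (hr0 : ∀ j, ∀ x ∈ U, r 0 j x = 0)
    (hr : ∀ n j, ∀ x ∈ U, r (n + 1) j x = γ j / h n x * ∫ y : ℝ, (P (n + 1) x).eval y * (P n x).eval y * w x y / (y - x j))
    (hPC2 : ∀ m k, ContDiffOn ℝ 2 (fun x => (P m x).coeff k) U)
    (hhC2 : ∀ m, ContDiffOn ℝ 2 (h m) U)
    (hαC2 : ∀ m, ContDiffOn ℝ 2 (α m) U)
    (hβC2 : ∀ m, ContDiffOn ℝ 2 (β m) U)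
    (hpC2 : ∀ m, ContDiffOn ℝ 2 (p m) U)
    (hRC2 : ∀ m j, ContDiffOn ℝ 2 (R m j) U)
    (hrC2 : ∀ m j, ContDiffOn ℝ 2 (r m j) U)
    (n : ℕ) (j : Fin N) (x : Fin N → ℝ) (hx : x ∈ U) :
    HasDerivAt (fun s => h n (Function.update x j s)) (-(h n x * R n j x)) (x j) ∧
      HasDerivAt (fun s => p n (Function.update x j s)) (r n j x) (x j) ∧
      (1 ≤ n → pd j (fun y => Real.log (β n y)) x = R (n - 1) j x - R n j x) ∧
      pd j (α n) x = r n j x - r (n + 1) j x := by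
  have hUx : ∀ᶠ s in nhds (x j), Function.update x j s ∈ U := by
    have hc : ContinuousAt (Function.update x j) (x j) :=
      (hasDerivAt_update x j (x j)).continuousAt
    exact hc (by rw [Function.update_eq_self]; exact hU.mem_nhds hx)
  have hdiff : ∀ f : (Fin N → ℝ) → ℝ, ContDiffOn ℝ 2 f U →
      DifferentiableAt ℝ (fun s => f (Function.update x j s)) (x j) := by
    intro f hf
    have h1 : DifferentiableAt ℝ f (Function.update x j (x j)) := by
      rw [Function.update_eq_self]
      exact (hf.contDiffAt (hU.mem_nhds hx)).differentiableAt (by norm_num)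
    exact h1.comp (x j) (hasDerivAt_update x j (x j)).differentiableAt
  have hwz : ∀ z ∈ U, w z = zeroWeight γ z := fun z hz => funext (hw z hz)
  let L : (Fin N → ℝ) → ℝ[X] →ₗ[ℝ] ℝ := fun z => weightFunctional hγ j z
  let D : ℝ[X] → ℝ := fun q => -(γ j * ∫ y, q.eval y * zeroWeight γ x y / (y - x j))
  have hLapp : ∀ z q, L z q = ∫ y, q.eval y * zeroWeight γ z y := fun _ _ => rfl
  have hLD : ∀ q, HasDerivAt (fun s => L (Function.update x j s) q) (D q) (x j) := fun q =>
    hasDerivAt_integral_eval_mul_zeroWeight hγ j x q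
  have hL : ∀ z ∈ U, ∀ m n, m ≠ n → L z (P m z * P n z) = 0 := by
    intro z hz m n hmn
    simpa only [hLapp, eval_mul, ← hwz z hz] using horth m n hmn z hz
  have hLh : ∀ z ∈ U, ∀ n, h n z = L z (P n z * P n z) := by
    intro z hz n
    simpa only [hLapp, eval_mul, ← hwz z hz, sq] using hh n z hz
  have hDR : ∀ n, D (P n x * P n x) = -(h n x * R n j x) := by
    intro n
    have := (hhpos n x hx).ne'
    simp only [D, hR n j x hx, hwz x hx, eval_mul, sq]
    field_simp
  have hDr : ∀ n, D (P (n + 1) x * P n x) = -(h n x * r (n + 1) j x) := by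
    intro n
    have := (hhpos n x hx).ne'
    simp only [D, hr n j x hx, hwz x hx, eval_mul]
    field_simp
  have horthx : ∀ (n : ℕ) (q : ℝ[X]), q.degree < n → L x (q * P n x) = 0 := fun n q hq =>
    orthogonal_of_degree_lt (fun n => hPmonic n x hx) (fun n => hPdeg n x hx) (hL x hx) hq
  have hPder : ∀ n : ℕ, ∃ A' : ℝ[X], A'.degree < n ∧
      HasPolyDerivAt (fun s => P n (Function.update x j s)) A' (x j) := by
    intro n
    refine hasPolyDerivAt_of_monic ?_ fun k => hdiff _ (hPC2 n k)
    filter_upwards [hUx] with s hs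
    exact ⟨hPmonic n _ hs, hPdeg n _ hs⟩
  have hhder : ∀ n, HasDerivAt (fun s => h n (Function.update x j s)) (-(h n x * R n j x))
      (x j) := by
    intro n
    obtain ⟨A', hA'd, hA'⟩ := hPder n
    have h1 := (hA'.mul hA').hasDerivAt_apply hLD
    simp only [Function.update_eq_self] at h1
    rw [map_add, mul_comm (P n x) A', horthx n A' hA'd, hDR, zero_add, zero_add] at h1
    refine h1.congr_of_eventuallyEq ?_
    filter_upwards [hUx] with s hs
    exact hLh _ hs n
  have hpder : ∀ n, HasDerivAt (fun s => p n (Function.update x j s)) (r n j x) (x j) := by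
    rintro (_ | n)
    · rw [hr0 j x hx]
      refine (hasDerivAt_const (x j) (0 : ℝ)).congr_of_eventuallyEq ?_
      filter_upwards [hUx] with s hs
      exact hp0 _ hs
    · obtain ⟨A', hA'd, hA'⟩ := hPder (n + 1)
      obtain ⟨B', hB'd, hB'⟩ := hPder n
      have h1 := (hA'.mul hB').hasDerivAt_apply hLD
      simp only [Function.update_eq_self] at h1
      have hB'd' : B'.degree < (n + 1 : ℕ) := hB'd.trans (by exact_mod_cast n.lt_succ_self)
      rw [map_add, mul_comm (P (n + 1) x) B', horthx (n + 1) B' hB'd', hDr,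
        apply_mul_of_degree_lt_succ (fun n => hPmonic n x hx) (fun n => hPdeg n x hx) (hL x hx)
          hA'd, ← hLh x hx] at h1
      have h2 := h1.unique ((hasDerivAt_const (x j) (0 : ℝ)).congr_of_eventuallyEq (by
        filter_upwards [hUx] with s hs
        exact hL _ hs (n + 1) n (by omega)))
      have h3 : A'.coeff n = r (n + 1) j x :=
        mul_right_cancel₀ (hhpos n x hx).ne' (by linarith)
      rw [← h3]
      refine (hA'.2 n).congr_of_eventuallyEq ?_
      filter_upwards [hUx] with s hs
      exact hp n _ hs
  refine ⟨hhder n, hpder n, ?_, ?_⟩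
  · intro hn
    obtain ⟨m, rfl⟩ : ∃ m, n = m + 1 := ⟨n - 1, by omega⟩
    rw [Nat.add_sub_cancel]
    have hne : ∀ k, h k (Function.update x j (x j)) ≠ 0 := by
      intro k
      rw [Function.update_eq_self]
      exact (hhpos k x hx).ne'
    have h1 := ((hhder (m + 1)).log (hne _)).fun_sub ((hhder m).log (hne _))
    simp only [Function.update_eq_self] at h1
    have h2 : pd j (fun y => Real.log (β (m + 1) y)) x = _ :=
      (h1.congr_of_eventuallyEq (by
        filter_upwards [hUx] with s hs
        rw [hβ m _ hs, Real.log_div (hhpos _ _ hs).ne' (hhpos _ _ hs).ne'])).deriv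
    rw [h2]
    have := (hhpos (m + 1) x hx).ne'
    have := (hhpos m x hx).ne'
    field_simp
    ring
  · have hαp : ∀ z ∈ U, α n z = p n z - p (n + 1) z := by
      intro z hz
      have hdeg : (X * P n z - P (n + 1) z).degree < ((n + 1 : ℕ) : WithBot ℕ) := by
        have := degree_sub_C_mul_lt (hPmonic (n + 1) z hz) (hPdeg (n + 1) z hz)
          (q := X * P n z) (by
            rw [degree_mul, degree_X, degree_eq_natDegree (hPmonic n z hz).ne_zero, hPdeg n z hz]
            exact_mod_cast (by omega : 1 + n < n + 1 + 1))
        have hc : (P n z).coeff n = 1 := by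
          have : (P n z).leadingCoeff = 1 := hPmonic n z hz
          rwa [leadingCoeff, hPdeg n z hz] at this
        rwa [coeff_X_mul, hc, C_1, one_mul] at this
      have hcoeff : (X * P n z - P (n + 1) z).coeff n = p n z - p (n + 1) z := by
        rw [coeff_sub, ← hp n z hz]
        congr 1
        rcases n with _ | n
        · rw [hp0 z hz, coeff_X_mul_zero]
        · rw [coeff_X_mul, hp n z hz]
      have h1 := apply_mul_of_degree_lt_succ (fun n => hPmonic n z hz) (fun n => hPdeg n z hz)
        (hL z hz) hdeg
      rw [sub_mul, map_sub, hL z hz (n + 1) n (by omega), sub_zero, ← hLh z hz, hcoeff] at h1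
      rw [hα n z hz, div_eq_iff (hhpos n z hz).ne', ← h1, hLapp]
      simp only [eval_mul, eval_X, hwz z hz, sq, mul_assoc]
    refine (((hpder n).fun_sub (hpder (n + 1))).congr_of_eventuallyEq ?_).deriv
    filter_upwards [hUx] with s hs
    exact hαp _ hs
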